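/- Let Φ : D² → ℝ³ be a smooth immersion. Then, pointwise on D², the following divergence identity holds (a consequence of the Codazzi–Mainardi equations): |g|^{−1/2} ∂_j[ |g|^{1/2}( g^{ik}g^{jl}h_{kl} − 2H g^{ij} ) ∂_iΦ ] = ( g^{ik}g^{jl} h_{kj} h_{li} − 4H² ) n. -/

import Mathlib

noncomputable section

open scoped RealInnerProductSpace

abbrev E2 : Type := EuclideanSpace ℝ (Fin 2)
abbrev E3 : Type := EuclideanSpace ℝ (Fin 3)

/-- Partial derivative of a map on `ℝ²` in the `i`-th coordinate direction. -/
def pd {F : Type*} [NormedAddCommGroup F] [NormedSpace ℝ F]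
    (i : Fin 2) (f : E2 → F) (x : E2) : F :=
  fderiv ℝ f x (EuclideanSpace.single i 1)

/-- Cross product on `ℝ³`. -/
def cross3 (u v : E3) : E3 :=
  (WithLp.equiv 2 (Fin 3 → ℝ)).symm
    ![u 1 * v 2 - u 2 * v 1, u 2 * v 0 - u 0 * v 2, u 0 * v 1 - u 1 * v 0]

/-- Induced metric. -/
def gm (Φ : E2 → E3) (x : E2) (i j : Fin 2) : ℝ :=
  ⟪pd i Φ x, pd j Φ x⟫

/-- Determinant of the induced metric. -/
def gdet (Φ : E2 → E3) (x : E2) : ℝ :=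
  gm Φ x 0 0 * gm Φ x 1 1 - gm Φ x 0 1 * gm Φ x 1 0

/-- Inverse metric. -/
def ginv (Φ : E2 → E3) (x : E2) (i j : Fin 2) : ℝ :=
  (Matrix.of (gm Φ x))⁻¹ i j

/-- Unit normal. -/
def nrm (Φ : E2 → E3) (x : E2) : E3 :=
  ‖cross3 (pd 0 Φ x) (pd 1 Φ x)‖⁻¹ • cross3 (pd 0 Φ x) (pd 1 Φ x)

/-- Scalar second fundamental form. -/
def sff3 (Φ : E2 → E3) (x : E2) (i j : Fin 2) : ℝ :=
  ⟪nrm Φ x, pd i (pd j Φ) x⟫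

/-- Scalar mean curvature. -/
def mc3 (Φ : E2 → E3) (x : E2) : ℝ :=
  (1/2 : ℝ) * ∑ i : Fin 2, ∑ j : Fin 2, ginv Φ x i j * sff3 Φ x i j

/-- Mean curvature vector. -/
def mcv3 (Φ : E2 → E3) (x : E2) : E3 := mc3 Φ x • nrm Φ x

/-- Levi-Civita symbol on two indices. -/
def eps (i j : Fin 2) : ℝ := ![![0, 1], ![-1, 0]] i j

/-- The open unit disk in `ℝ²`. -/
def Disk : Set E2 := Metric.ball 0 1

/-- Immersion condition on the disk. -/
def ImmersedOn (Φ : E2 → E3) : Prop :=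
  ∀ x ∈ Disk, LinearIndependent ℝ ![pd 0 Φ x, pd 1 Φ x]

end

section DivergenceIdentity

open scoped RealInnerProductSpace

theorem cross3_apply (u v : E3) : cross3 u v =
    !₂[u 1 * v 2 - u 2 * v 1, u 2 * v 0 - u 0 * v 2, u 0 * v 1 - u 1 * v 0] := rfl

/-- The cross product as a continuous bilinear map. -/
noncomputable def cross3L : E3 →L[ℝ] E3 →L[ℝ] E3 :=
  (LinearMap.mk₂ ℝ cross3
    (fun u u' v => by ext i; fin_cases i <;> simp [cross3_apply] <;> ring)
    (fun c u v => by ext i; fin_cases i <;> simp [cross3_apply] <;> ring)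
    (fun u v v' => by ext i; fin_cases i <;> simp [cross3_apply] <;> ring)
    (fun c u v => by ext i; fin_cases i <;> simp [cross3_apply] <;> ring)).toContinuousBilinearMap

theorem cross3L_apply (u v : E3) : cross3L u v = cross3 u v := rfl

theorem inner_eq3 (u v : E3) : ⟪u, v⟫ = u 0 * v 0 + u 1 * v 1 + u 2 * v 2 := by
  simp [PiLp.inner_apply, Fin.sum_univ_three]; ring

theorem cross3_self (u : E3) : cross3 u u = 0 := by
  ext i; fin_cases i <;> simp [cross3_apply] <;> ring

theorem cross3_swap (u v : E3) : cross3 v u = -cross3 u v := by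
  ext i; fin_cases i <;> simp [cross3_apply] <;> ring

theorem norm_cross3_sq (u v : E3) :
    ‖cross3 u v‖ ^ 2 = ⟪u, u⟫ * ⟪v, v⟫ - ⟪u, v⟫ * ⟪v, u⟫ := by
  rw [← real_inner_self_eq_norm_sq]
  simp only [inner_eq3, cross3_apply]
  simp
  ring

theorem cross3_ne_zero {u v : E3} (h : LinearIndependent ℝ ![u, v]) : cross3 u v ≠ 0 := by
  intro h0
  have h1 := norm_cross3_sq u v
  rw [h0, norm_zero] at h1
  rw [LinearIndependent.pair_iff] at h
  have key : ⟪u, v⟫ • u + (-⟪u, u⟫) • v = 0 := by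
    rw [← inner_self_eq_zero (𝕜 := ℝ)]
    simp only [inner_add_left, inner_add_right, inner_smul_left, inner_smul_right]
    rw [real_inner_comm u v] at h1 ⊢
    simp only [map_neg, conj_trivial]
    linear_combination (-⟪u, u⟫) * h1
  have h2 := (h _ _ key).2
  have h3 : u = 0 := by simpa using h2
  simpa using (h 1 0 (by simp [h3])).1

/-- `(u × v) × (a × v + u × b) = ⟪u × v, b⟫ u - ⟪u × v, a⟫ v`. -/
theorem cross3_cross3_deriv (u v a b : E3) :
    cross3 (cross3 u v) (cross3 a v + cross3 u b) =
      ⟪cross3 u v, b⟫ • u - ⟪cross3 u v, a⟫ • v := by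
  simp only [inner_eq3]
  ext i; fin_cases i <;> simp [cross3_apply] <;> ring

theorem cross3_cross3_cross3 (n a b : E3) :
    cross3 (cross3 n a) (cross3 n b) = ⟪n, cross3 a b⟫ • n := by
  simp only [inner_eq3]
  ext i; fin_cases i <;> simp [cross3_apply] <;> ring

/-- The cross product of two vectors orthogonal to a unit vector `n` is a multiple of `n`. -/
theorem cross3_eq_inner_smul {n a b : E3} (hn : ⟪n, n⟫ = 1) (ha : ⟪n, a⟫ = 0)
    (hb : ⟪n, b⟫ = 0) : cross3 a b = ⟪n, cross3 a b⟫ • n := by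
  have key : cross3 a b = ⟪n, n⟫ • cross3 a b := by rw [hn, one_smul]
  have h2 : ⟪n, n⟫ • cross3 a b = ⟪n, cross3 a b⟫ • n + ⟪n, a⟫ • cross3 n b
      - ⟪n, b⟫ • cross3 n a := by
    simp only [inner_eq3]
    ext i; fin_cases i <;> simp [cross3_apply] <;> ring
  rw [ha, hb] at h2
  simp only [zero_smul, add_zero, sub_zero] at h2
  exact key.trans h2

section PartialDerivatives

variable {F : Type*} [NormedAddCommGroup F] [NormedSpace ℝ F] {x : E2}

theorem contDiffAt_pd {f : E2 → F} (hf : ContDiffAt ℝ (⊤ : ℕ∞) f x) (i : Fin 2) :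
    ContDiffAt ℝ (⊤ : ℕ∞) (pd i f) x :=
  (hf.fderiv_right (m := ((⊤ : ℕ∞) : WithTop ℕ∞)) (by simp)).clm_apply contDiffAt_const

theorem pd_pd_eq {f : E2 → F} (hf : ContDiffAt ℝ (⊤ : ℕ∞) f x) (i j : Fin 2) :
    pd i (pd j f) x = fderiv ℝ (fderiv ℝ f) x (EuclideanSpace.single i 1)
      (EuclideanSpace.single j 1) := by
  have h : DifferentiableAt ℝ (fderiv ℝ f) x :=
    (hf.fderiv_right (m := ((⊤ : ℕ∞) : WithTop ℕ∞)) (by simp)).differentiableAt (by simp)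
  unfold pd
  rw [fderiv_clm_apply h (differentiableAt_const _)]
  simp

theorem pd_comm {f : E2 → F} (hf : ContDiffAt ℝ (⊤ : ℕ∞) f x) (i j : Fin 2) :
    pd i (pd j f) x = pd j (pd i f) x := by
  rw [pd_pd_eq hf, pd_pd_eq hf]
  exact hf.isSymmSndFDerivAt (by simp; exact WithTop.coe_le_coe.2 le_top) _ _

theorem pd_congr {f g : E2 → F} (h : f =ᶠ[nhds x] g) (i : Fin 2) : pd i f x = pd i g x := by
  simp only [pd, h.fderiv_eq]

theorem pd_cross3 {f g : E2 → E3} (hf : DifferentiableAt ℝ f x) (hg : DifferentiableAt ℝ g x)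
    (i : Fin 2) :
    pd i (fun y => cross3 (f y) (g y)) x = cross3 (pd i f x) (g x) + cross3 (f x) (pd i g x) := by
  have h := cross3L.fderiv_of_bilinear hf hg
  simp only [cross3L_apply] at h
  simp only [pd, h]
  simp [cross3L_apply, add_comm]

theorem contDiffAt_cross3 {f g : E2 → E3} (hf : ContDiffAt ℝ (⊤ : ℕ∞) f x)
    (hg : ContDiffAt ℝ (⊤ : ℕ∞) g x) :
    ContDiffAt ℝ (⊤ : ℕ∞) (fun y => cross3 (f y) (g y)) x :=
  cross3L.isBoundedBilinearMap.contDiff.contDiffAt.comp x (hf.prodMk hg)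

end PartialDerivatives

section Immersion

variable {Φ : E2 → E3} {x : E2}

theorem contDiffAt_nrm (hΦ : ContDiffAt ℝ (⊤ : ℕ∞) Φ x)
    (h0 : cross3 (pd 0 Φ x) (pd 1 Φ x) ≠ 0) : ContDiffAt ℝ (⊤ : ℕ∞) (nrm Φ) x := by
  have hN := contDiffAt_cross3 (contDiffAt_pd hΦ 0) (contDiffAt_pd hΦ 1)
  exact ((hN.norm ℝ h0).inv (norm_ne_zero_iff.2 h0)).smul hN

theorem gdet_eq (Φ : E2 → E3) (x : E2) :
    gdet Φ x = ‖cross3 (pd 0 Φ x) (pd 1 Φ x)‖ ^ 2 := (norm_cross3_sq _ _).symm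

theorem sqrt_gdet (Φ : E2 → E3) (x : E2) :
    Real.sqrt (gdet Φ x) = ‖cross3 (pd 0 Φ x) (pd 1 Φ x)‖ := by
  rw [gdet_eq, Real.sqrt_sq (norm_nonneg _)]

theorem inner_nrm_nrm (h0 : cross3 (pd 0 Φ x) (pd 1 Φ x) ≠ 0) : ⟪nrm Φ x, nrm Φ x⟫ = 1 := by
  rw [real_inner_self_eq_norm_sq, nrm, norm_smul, norm_inv, norm_norm,
    inv_mul_cancel₀ (norm_ne_zero_iff.2 h0), one_pow]

theorem inner_nrm_pd_nrm (hΦ : ContDiffAt ℝ (⊤ : ℕ∞) Φ x)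
    (h0 : ∀ᶠ y in nhds x, cross3 (pd 0 Φ y) (pd 1 Φ y) ≠ 0) (l : Fin 2) :
    ⟪nrm Φ x, pd l (nrm Φ) x⟫ = 0 := by
  have hd := (contDiffAt_nrm hΦ h0.self_of_nhds).differentiableAt (by simp)
  have h1 : (fun y => ⟪nrm Φ y, nrm Φ y⟫) =ᶠ[nhds x] fun _ => (1 : ℝ) :=
    h0.mono fun y hy => inner_nrm_nrm hy
  have h2 := pd_congr h1 l
  simp only [pd, fderiv_inner_apply ℝ hd hd, fderiv_fun_const, Pi.zero_apply,
    zero_apply] at h2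
  rw [real_inner_comm (nrm Φ x)] at h2
  unfold pd
  linarith

theorem cross3_nrm_pd_nrm (hΦ : ContDiffAt ℝ (⊤ : ℕ∞) Φ x)
    (h0 : cross3 (pd 0 Φ x) (pd 1 Φ x) ≠ 0) (l : Fin 2) :
    cross3 (nrm Φ x) (pd l (nrm Φ) x) =
      ‖cross3 (pd 0 Φ x) (pd 1 Φ x)‖⁻¹ • (sff3 Φ x l 1 • pd 0 Φ x - sff3 Φ x l 0 • pd 1 Φ x) := by
  have hN := contDiffAt_cross3 (contDiffAt_pd hΦ 0) (contDiffAt_pd hΦ 1)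
  have hi := (hN.norm ℝ h0).inv (norm_ne_zero_iff.2 h0)
  have h1 : pd l (nrm Φ) x = ‖cross3 (pd 0 Φ x) (pd 1 Φ x)‖⁻¹ •
        (cross3 (pd l (pd 0 Φ) x) (pd 1 Φ x) + cross3 (pd 0 Φ x) (pd l (pd 1 Φ) x)) +
      pd l (fun y => ‖cross3 (pd 0 Φ y) (pd 1 Φ y)‖⁻¹) x • cross3 (pd 0 Φ x) (pd 1 Φ x) := by
    rw [← pd_cross3 ((contDiffAt_pd hΦ 0).differentiableAt (by simp))
      ((contDiffAt_pd hΦ 1).differentiableAt (by simp))]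
    have := fderiv_fun_smul (hi.differentiableAt (by simp)) (hN.differentiableAt (by simp))
    exact congrArg (fun L => L (EuclideanSpace.single l 1)) this
  rw [h1]
  simp only [sff3, nrm, ← cross3L_apply, map_add, map_smul, smul_apply]
  simp only [cross3L_apply, cross3_self, smul_zero, add_zero]
  have h2 := cross3_cross3_deriv (pd 0 Φ x) (pd 1 Φ x) (pd l (pd 0 Φ) x) (pd l (pd 1 Φ) x)
  rw [← cross3L_apply, map_add, cross3L_apply, cross3L_apply] at h2
  rw [← smul_add, h2, real_inner_smul_left, real_inner_smul_left]
  module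

theorem ginv_eq (Φ : E2 → E3) (x : E2) : ginv Φ x =
    (gdet Φ x)⁻¹ • ![![gm Φ x 1 1, -gm Φ x 0 1], ![-gm Φ x 1 0, gm Φ x 0 0]] := by
  ext i j
  simp only [ginv, Matrix.inv_def, Matrix.adjugate_fin_two, Matrix.det_fin_two, Ring.inverse_eq_inv']
  fin_cases i <;> fin_cases j <;> simp [gdet]

theorem gm_comm (Φ : E2 → E3) (x : E2) : gm Φ x 1 0 = gm Φ x 0 1 := real_inner_comm _ _

theorem sff3_comm (hΦ : ContDiffAt ℝ (⊤ : ℕ∞) Φ x) : sff3 Φ x 1 0 = sff3 Φ x 0 1 := by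
  rw [sff3, pd_comm hΦ, sff3]

/-- In dimension two, `h^{ij} - 2 H g^{ij}` is minus the cofactor matrix of `h` over `|g|`. -/
theorem raise_sff3_sub (hΦ : ContDiffAt ℝ (⊤ : ℕ∞) Φ x) (h0 : gdet Φ x ≠ 0) (i j : Fin 2) :
    (∑ k : Fin 2, ∑ l : Fin 2, ginv Φ x i k * ginv Φ x j l * sff3 Φ x k l)
        - 2 * mc3 Φ x * ginv Φ x i j =
      -(gdet Φ x)⁻¹ * (![![sff3 Φ x 1 1, -sff3 Φ x 0 1], ![-sff3 Φ x 0 1, sff3 Φ x 0 0]] i j) := by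
  have hd : gdet Φ x = gm Φ x 0 0 * gm Φ x 1 1 - gm Φ x 0 1 * gm Φ x 0 1 := by
    rw [gdet, gm_comm]
  simp only [mc3, ginv_eq, Fin.sum_univ_two, sff3_comm hΦ, gm_comm]
  fin_cases i <;> fin_cases j <;> simp <;> field_simp <;> rw [hd] <;> ring

/-- `|h|² - (2H)² = -2 det h / det g`. -/
theorem norm_sq_sff3_sub (hΦ : ContDiffAt ℝ (⊤ : ℕ∞) Φ x) (h0 : gdet Φ x ≠ 0) :
    (∑ i : Fin 2, ∑ j : Fin 2, ∑ k : Fin 2, ∑ l : Fin 2,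
        ginv Φ x i k * ginv Φ x j l * sff3 Φ x k j * sff3 Φ x l i) - 4 * mc3 Φ x ^ 2 =
      -2 * (gdet Φ x)⁻¹ * (sff3 Φ x 0 0 * sff3 Φ x 1 1 - sff3 Φ x 0 1 ^ 2) := by
  have hd : gdet Φ x = gm Φ x 0 0 * gm Φ x 1 1 - gm Φ x 0 1 * gm Φ x 0 1 := by
    rw [gdet, gm_comm]
  simp only [mc3, ginv_eq, Fin.sum_univ_two, sff3_comm hΦ, gm_comm]
  simp
  field_simp
  rw [hd]
  ring

/-- `∂₀n × ∂₁n = (det h / |g|^{1/2}) n`. -/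
theorem cross3_pd_nrm_pd_nrm (hΦ : ContDiffAt ℝ (⊤ : ℕ∞) Φ x)
    (h0 : ∀ᶠ y in nhds x, cross3 (pd 0 Φ y) (pd 1 Φ y) ≠ 0) :
    cross3 (pd 0 (nrm Φ) x) (pd 1 (nrm Φ) x) =
      ((sff3 Φ x 0 0 * sff3 Φ x 1 1 - sff3 Φ x 0 1 ^ 2) *
        ‖cross3 (pd 0 Φ x) (pd 1 Φ x)‖⁻¹) • nrm Φ x := by
  have hx := h0.self_of_nhds
  rw [cross3_eq_inner_smul (inner_nrm_nrm hx) (inner_nrm_pd_nrm hΦ h0 0)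
    (inner_nrm_pd_nrm hΦ h0 1), ← cross3_cross3_cross3, cross3_nrm_pd_nrm hΦ hx,
    cross3_nrm_pd_nrm hΦ hx, sff3_comm hΦ]
  simp only [nrm, ← cross3L_apply, map_sub, map_smul, smul_apply,
    sub_apply]
  simp only [cross3L_apply, cross3_self]
  rw [cross3_swap (pd 0 Φ x) (pd 1 Φ x)]
  module

end Immersion

theorem eventually_cross3_ne_zero {Φ : E2 → E3} (himm : ImmersedOn Φ) {x : E2} (hx : x ∈ Disk) :
    ∀ᶠ y in nhds x, cross3 (pd 0 Φ y) (pd 1 Φ y) ≠ 0 :=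
  Filter.eventually_of_mem (Metric.isOpen_ball.mem_nhds hx) fun y hy => cross3_ne_zero (himm y hy)

end DivergenceIdentity

/-- divergence identity following from the Codazzi–Mainardi equations:
`|g|^{-1/2} ∂_j[|g|^{1/2}(g^{ik}g^{jl}h_{kl} - 2H g^{ij})∂_iΦ] = (g^{ik}g^{jl}h_{kj}h_{li} - 4H²) n`. -/
theorem codazzi_divergence_identity (Φ : E2 → E3)
    (hΦ : ContDiffOn ℝ (⊤ : ℕ∞) Φ Disk) (himm : ImmersedOn Φ) :
    ∀ x ∈ Disk,
      (Real.sqrt (gdet Φ x))⁻¹ •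
          (∑ j : Fin 2, pd j (fun y => Real.sqrt (gdet Φ y) •
            ∑ i : Fin 2,
              ((∑ k : Fin 2, ∑ l : Fin 2, ginv Φ y i k * ginv Φ y j l * sff3 Φ y k l)
                - 2 * mc3 Φ y * ginv Φ y i j) • pd i Φ y) x)
        = ((∑ i : Fin 2, ∑ j : Fin 2, ∑ k : Fin 2, ∑ l : Fin 2,
              ginv Φ x i k * ginv Φ x j l * sff3 Φ x k j * sff3 Φ x l i)
            - 4 * mc3 Φ x ^ 2) • nrm Φ x := by
  intro x hx
  have hsm : ∀ y ∈ Disk, ContDiffAt ℝ (⊤ : ℕ∞) Φ y := fun y hy =>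
    hΦ.contDiffAt (Metric.isOpen_ball.mem_nhds hy)
  have hN0 : ∀ y ∈ Disk, cross3 (pd 0 Φ y) (pd 1 Φ y) ≠ 0 := fun y hy => cross3_ne_zero (himm y hy)
  have hev := eventually_cross3_ne_zero himm hx
  have hn := contDiffAt_nrm (hsm x hx) (hN0 x hx)
  have hg : ∀ y ∈ Disk, gdet Φ y ≠ 0 := fun y hy => by
    rw [gdet_eq]; exact pow_ne_zero 2 (norm_ne_zero_iff.2 (hN0 y hy))
  have hfield : ∀ j : Fin 2, (fun y => Real.sqrt (gdet Φ y) •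
      ∑ i : Fin 2,
        ((∑ k : Fin 2, ∑ l : Fin 2, ginv Φ y i k * ginv Φ y j l * sff3 Φ y k l)
          - 2 * mc3 Φ y * ginv Φ y i j) • pd i Φ y) =ᶠ[nhds x] fun y =>
      cross3 (nrm Φ y) (![-pd 1 (nrm Φ) y, pd 0 (nrm Φ) y] j) := fun j => by
    filter_upwards [Metric.isOpen_ball.mem_nhds hx] with y hy
    have hW := norm_ne_zero_iff.2 (hN0 y hy)
    simp only [raise_sff3_sub (hsm y hy) (hg y hy)]
    rw [sqrt_gdet, gdet_eq, Fin.sum_univ_two]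
    have h1 := cross3_nrm_pd_nrm (hsm y hy) (hN0 y hy)
    generalize hw : ‖cross3 (pd 0 Φ y) (pd 1 Φ y)‖ = W at *
    have hWW : W * (W ^ 2)⁻¹ = W⁻¹ := by field_simp
    fin_cases j
    · have h2 : cross3 (nrm Φ y) (-pd 1 (nrm Φ) y) = -cross3 (nrm Φ y) (pd 1 (nrm Φ) y) := by
        simp only [← cross3L_apply, map_neg]
      simp [h2, h1, sff3_comm (hsm y hy), smul_smul, ← hWW]
      module
    · simp [h1, smul_smul, ← hWW]
      module
  have hd : DifferentiableAt ℝ (nrm Φ) x := hn.differentiableAt (by simp)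
  have hdd : ∀ i, DifferentiableAt ℝ (pd i (nrm Φ)) x := fun i =>
    (contDiffAt_pd hn i).differentiableAt (by simp)
  have hneg : pd 0 (fun y => -pd 1 (nrm Φ) y) x = -pd 0 (pd 1 (nrm Φ)) x := by
    rw [pd, fderiv_fun_neg]; rfl
  have hsum : cross3 (pd 0 (nrm Φ) x) (-pd 1 (nrm Φ) x)
        + cross3 (nrm Φ x) (-pd 0 (pd 1 (nrm Φ)) x)
        + (cross3 (pd 1 (nrm Φ) x) (pd 0 (nrm Φ) x)
        + cross3 (nrm Φ x) (pd 0 (pd 1 (nrm Φ)) x)) =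
      (-2 : ℝ) • cross3 (pd 0 (nrm Φ) x) (pd 1 (nrm Φ) x) := by
    rw [cross3_swap (pd 0 (nrm Φ) x) (pd 1 (nrm Φ) x)]
    simp only [← cross3L_apply, map_neg]
    module
  rw [Fin.sum_univ_two, pd_congr (hfield 0), pd_congr (hfield 1)]
  simp only [Matrix.cons_val_zero, Matrix.cons_val_one]
  rw [pd_cross3 hd (hdd 1).fun_neg, pd_cross3 hd (hdd 0), hneg, pd_comm hn 1 0, hsum,
    cross3_pd_nrm_pd_nrm (hsm x hx) hev, norm_sq_sff3_sub (hsm x hx) (hg x hx), sqrt_gdet, gdet_eq,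
    smul_smul, smul_smul]
  congr 1
  ring
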